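/- The asymptotic density of neutral head normal forms among all λ-terms equals ρ: the sequence Nat.card {t : Term // Nhnf t ∧ size t = n} / L n (as real numbers) tends to ρ ≈ 0.29559 as n → ∞. -/

import Mathlib

inductive Term : Type
  | idx : ℕ → Term
  | app : Term → Term → Term
  | abs : Term → Term

def Term.size : Term → ℕ
  | .idx n => n + 1
  | .app t u => t.size + u.size + 1
  | .abs t => t.size + 1

noncomputable def L (n : ℕ) : ℕ := Nat.card {t : Term // t.size = n}

inductive Nhnf : Term → Prop
  | idx (n : ℕ) : Nhnf (.idx n)
  | app {t : Term} (u : Term) : Nhnf t → Nhnf (.app t u)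


namespace Term

lemma finite_size_eq (n : ℕ) : Finite {t : Term // t.size = n} := by
  induction n using Nat.strong_induction_on with
  | _ n ih =>
    have hfin : ∀ m < n, {t : Term | t.size = m}.Finite := fun m hm => ih m hm
    have hle : {t : Term | t.size < n}.Finite := by
      refine ((Set.finite_Iio n).biUnion hfin).subset ?_
      intro t ht
      simpa using ht
    refine ((Set.finite_singleton (idx (n - 1))).union
      ((hle.image abs).union (hle.image2 app hle))).subset ?_
    rintro (k | ⟨t, u⟩ | t) h
    · left
      have : k + 1 = n := h
      simp [← this]
    · right; right
      have : t.size + u.size + 1 = n := h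
      exact Set.mem_image2_of_mem (by simp; omega) (by simp; omega)
    · right; left
      have : t.size + 1 = n := h
      exact Set.mem_image_of_mem _ (by simp; omega)

instance (n : ℕ) : Finite {t : Term // t.size = n} := finite_size_eq n

instance (n : ℕ) : Finite {t : Term // Nhnf t ∧ t.size = n} :=
  Finite.of_injective
    (fun t => (⟨t.1, t.2.2⟩ : {t : Term // t.size = n}))
    fun _ _ h => Subtype.ext (congrArg (fun s : {t : Term // t.size = n} => s.1) h)

lemma size_pos (t : Term) : 0 < t.size := by cases t <;> simp [size]

end Term

open Finset

/-- The number of neutral head normal forms of size `n`. -/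
noncomputable def nhnfCount (n : ℕ) : ℕ := Nat.card {t : Term // Nhnf t ∧ t.size = n}

lemma L_zero : L 0 = 0 := by
  have : IsEmpty {t : Term // t.size = 0} := ⟨fun t => t.1.size_pos.ne' t.2⟩
  exact Nat.card_of_isEmpty

lemma nhnfCount_zero : nhnfCount 0 = 0 := by
  have : IsEmpty {t : Term // Nhnf t ∧ t.size = 0} := ⟨fun t => t.1.size_pos.ne' t.2.2⟩
  exact Nat.card_of_isEmpty

lemma L_succ (n : ℕ) : L (n + 1) = 1 + L n + ∑ p ∈ antidiagonal n, L p.1 * L p.2 := by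
  let F : Option ({t : Term // t.size = n} ⊕ Σ p : antidiagonal n,
      {t : Term // t.size = p.1.1} × {t : Term // t.size = p.1.2}) →
      {t : Term // t.size = n + 1} := fun x => match x with
    | none => ⟨.idx n, rfl⟩
    | some (.inl t) => ⟨.abs t.1, by simp [Term.size, t.2]⟩
    | some (.inr ⟨p, t, u⟩) => ⟨.app t.1 u.1, by
        simp [Term.size, t.2, u.2, HasAntidiagonal.mem_antidiagonal.1 p.2]⟩
  have hF : F.Bijective := by
    constructor
    · rintro (_ | ⟨t, ht⟩ | ⟨⟨⟨i, j⟩, hp⟩, ⟨t, ht⟩, ⟨u, hu⟩⟩)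
        (_ | ⟨t', ht'⟩ | ⟨⟨⟨i', j'⟩, hp'⟩, ⟨t', ht'⟩, ⟨u', hu'⟩⟩) h <;>
        replace h := congrArg Subtype.val h <;>
        simp only [F, reduceCtorEq, Term.abs.injEq, Term.app.injEq] at h
      · rfl
      · subst h; rfl
      · obtain ⟨rfl, rfl⟩ := h
        dsimp only at ht hu ht' hu'
        subst ht hu ht' hu'
        rfl
    · rintro ⟨k | ⟨t, u⟩ | t, h⟩
      · simp only [Term.size] at h
        exact ⟨none, Subtype.ext (congrArg Term.idx (by omega))⟩
      · simp only [Term.size] at h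
        exact ⟨some (.inr ⟨⟨(t.size, u.size), HasAntidiagonal.mem_antidiagonal.2 (by simp; omega)⟩,
          ⟨t, rfl⟩, ⟨u, rfl⟩⟩), rfl⟩
      · simp only [Term.size] at h
        exact ⟨some (.inl ⟨t, by omega⟩), rfl⟩
  rw [L, ← Nat.card_congr (Equiv.ofBijective F hF), Finite.card_option, Nat.card_sum,
    Nat.card_sigma]
  simp only [Nat.card_prod]
  change L n + ∑ p : antidiagonal n, L p.1.1 * L p.1.2 + 1 = _
  rw [Finset.sum_coe_sort (antidiagonal n) (fun p => L p.1 * L p.2)]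
  ring

lemma nhnfCount_succ (n : ℕ) :
    nhnfCount (n + 1) = 1 + ∑ p ∈ antidiagonal n, nhnfCount p.1 * L p.2 := by
  let F : Option (Σ p : antidiagonal n,
      {t : Term // Nhnf t ∧ t.size = p.1.1} × {t : Term // t.size = p.1.2}) →
      {t : Term // Nhnf t ∧ t.size = n + 1} := fun x => match x with
    | none => ⟨.idx n, .idx n, rfl⟩
    | some ⟨p, t, u⟩ => ⟨.app t.1 u.1, .app _ t.2.1, by
        simp [Term.size, t.2.2, u.2, HasAntidiagonal.mem_antidiagonal.1 p.2]⟩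
  have hF : F.Bijective := by
    constructor
    · rintro (_ | ⟨⟨⟨i, j⟩, hp⟩, ⟨t, hn, ht⟩, ⟨u, hu⟩⟩)
        (_ | ⟨⟨⟨i', j'⟩, hp'⟩, ⟨t', hn', ht'⟩, ⟨u', hu'⟩⟩) h <;>
        replace h := congrArg Subtype.val h <;>
        simp only [F, reduceCtorEq, Term.app.injEq] at h
      · rfl
      · obtain ⟨rfl, rfl⟩ := h
        dsimp only at ht hu ht' hu'
        subst ht hu ht' hu'
        rfl
    · rintro ⟨_, hn, h⟩
      cases hn with
      | idx k =>
        simp only [Term.size] at h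
        exact ⟨none, Subtype.ext (congrArg Term.idx (by omega))⟩
      | @app t u ht =>
        simp only [Term.size] at h
        exact ⟨some ⟨⟨(t.size, u.size), HasAntidiagonal.mem_antidiagonal.2 (by simp; omega)⟩,
          ⟨t, ht, rfl⟩, ⟨u, rfl⟩⟩, rfl⟩
  rw [nhnfCount, ← Nat.card_congr (Equiv.ofBijective F hF), Finite.card_option,
    Nat.card_sigma]
  simp only [Nat.card_prod]
  change ∑ p : antidiagonal n, nhnfCount p.1.1 * L p.1.2 + 1 = _
  rw [Finset.sum_coe_sort (antidiagonal n) (fun p => nhnfCount p.1 * L p.2)]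
  exact add_comm _ _

lemma nhnfCount_one : nhnfCount 1 = 1 := by
  simp [nhnfCount_succ 0, nhnfCount_zero]

lemma nhnfCount_add_two (n : ℕ) : nhnfCount (n + 2) = L (n + 1) := by
  induction n using Nat.strong_induction_on with
  | _ n ih =>
    rw [nhnfCount_succ, Nat.sum_antidiagonal_succ, nhnfCount_zero, L_succ]
    have key : ∀ p ∈ antidiagonal n, nhnfCount (p.1 + 1) * L p.2 =
        (if p.1 = 0 then L p.2 else 0) + L p.1 * L p.2 := by
      rintro ⟨i, j⟩ hp
      rw [HasAntidiagonal.mem_antidiagonal] at hp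
      rcases i with _ | i
      · simp [nhnfCount_one, L_zero]
      · simp [ih i (by simp at hp; omega)]
    rw [sum_congr rfl key, sum_add_distrib]
    have : ∑ p ∈ antidiagonal n, (if p.1 = 0 then L p.2 else 0) = L n := by
      rw [sum_eq_single (0, n)]
      · simp
      · rintro ⟨i, j⟩ hp hne
        rw [HasAntidiagonal.mem_antidiagonal] at hp
        refine if_neg fun h => hne ?_
        simp_all
      · simp
    rw [this]
    ring

namespace PowerSeries

/-- The power series `√(1 - c X)`. -/
noncomputable def sqrtOneSub (c : ℝ) : PowerSeries ℝ :=
  rescale (-c) (binomialSeries ℝ (1 / 2 : ℝ))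

lemma sqrtOneSub_mul_self (c : ℝ) : sqrtOneSub c * sqrtOneSub c = 1 - C c * X := by
  rw [sqrtOneSub, ← map_mul, ← binomialSeries_add]
  have h := binomialSeries_nat (R := ℝ) (A := ℝ) 1
  norm_num at h ⊢
  rw [h]
  ext n
  rcases n with _ | _ | n <;> simp [coeff_one]

end PowerSeries

/-- The coefficients of `√(1 - X)`. -/
noncomputable def sqrtCoeff (n : ℕ) : ℝ := (-1) ^ n * Ring.choose (1 / 2 : ℝ) n

lemma PowerSeries.coeff_sqrtOneSub (c : ℝ) (n : ℕ) :
    coeff n (sqrtOneSub c) = sqrtCoeff n * c ^ n := by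
  simp [sqrtOneSub, sqrtCoeff, coeff_rescale, neg_pow c]
  ring

lemma sqrtCoeff_zero : sqrtCoeff 0 = 1 := by simp [sqrtCoeff]

lemma sqrtCoeff_succ (n : ℕ) : sqrtCoeff (n + 1) * (n + 1) = sqrtCoeff n * (n - 1 / 2) := by
  have h := Ring.choose_smul_choose (1 / 2 : ℝ) (Nat.le_succ n)
  simp [-one_div] at h
  simp only [sqrtCoeff, pow_succ]
  linear_combination (-(-1) ^ n) * h

lemma sqrtCoeff_one : sqrtCoeff 1 = -1 / 2 := by
  have := sqrtCoeff_succ 0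
  norm_num [sqrtCoeff_zero] at this ⊢
  exact this

lemma sqrtCoeff_succ_neg (n : ℕ) : sqrtCoeff (n + 1) < 0 := by
  induction n with
  | zero => norm_num [sqrtCoeff_one]
  | succ n ih =>
    have h := sqrtCoeff_succ (n + 1)
    push_cast at h
    by_contra! hc
    nlinarith [mul_nonneg hc (by positivity : (0 : ℝ) ≤ n + 1 + 1),
      mul_pos (neg_pos.2 ih) (by positivity : (0 : ℝ) < n + 1 / 2)]

lemma sqrtCoeff_ne_zero (n : ℕ) : sqrtCoeff n ≠ 0 := by
  rcases n with _ | n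
  · simp [sqrtCoeff_zero]
  · exact (sqrtCoeff_succ_neg n).ne

lemma antitone_sq_mul_sqrtCoeff :
    Antitone fun n : ℕ => ((n : ℝ) + 1) ^ 2 * sqrtCoeff (n + 1) := by
  refine antitone_nat_of_succ_le fun n => ?_
  have h := sqrtCoeff_succ (n + 1)
  have hn := sqrtCoeff_succ_neg n
  push_cast at h ⊢
  have : ((n : ℝ) + 1 + 1) ^ 2 * sqrtCoeff (n + 1 + 1)
      = (n + 2) * (n + 1 / 2) * sqrtCoeff (n + 1) := by
    linear_combination ((n : ℝ) + 2) * h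
  rw [this]
  refine mul_le_mul_of_nonpos_right ?_ hn.le
  nlinarith [(Nat.cast_nonneg n : (0 : ℝ) ≤ n)]

lemma abs_sqrtCoeff_le {k n : ℕ} (hkn : k ≤ n) :
    |sqrtCoeff (n - k)| ≤ 2 * ((k : ℝ) + 1) ^ 2 * |sqrtCoeff n| := by
  obtain ⟨m, rfl⟩ := Nat.exists_eq_add_of_le' hkn
  rw [Nat.add_sub_cancel]
  rcases m with _ | m
  · rcases k with _ | k
    · norm_num [sqrtCoeff_zero]
    · have h := antitone_sq_mul_sqrtCoeff (Nat.zero_le k)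
      have hk := sqrtCoeff_succ_neg k
      simp only [zero_add, sqrtCoeff_zero, abs_one, abs_of_neg hk, sqrtCoeff_one] at h ⊢
      push_cast at h ⊢
      nlinarith [(Nat.cast_nonneg k : (0 : ℝ) ≤ k)]
  · have h := antitone_sq_mul_sqrtCoeff (Nat.le_add_right m k)
    have h1 := sqrtCoeff_succ_neg m
    have h2 := sqrtCoeff_succ_neg (m + k)
    rw [show m + 1 + k = m + k + 1 by ring, abs_of_neg h1, abs_of_neg h2]
    push_cast at h
    have hm : (0 : ℝ) < ((m : ℝ) + 1) ^ 2 := by positivity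
    have hle : ((m : ℝ) + k + 1) ^ 2 ≤ ((m : ℝ) + 1) ^ 2 * ((k : ℝ) + 1) ^ 2 := by
      rw [← mul_pow]
      refine pow_le_pow_left₀ (by positivity) ?_ 2
      nlinarith [mul_nonneg (Nat.cast_nonneg m : (0 : ℝ) ≤ m) (Nat.cast_nonneg k : (0 : ℝ) ≤ k)]
    have h3 : ((m : ℝ) + 1) ^ 2 * -sqrtCoeff (m + 1) ≤
        ((m : ℝ) + 1) ^ 2 * (((k : ℝ) + 1) ^ 2 * -sqrtCoeff (m + k + 1)) := by
      have := mul_le_mul_of_nonneg_right hle (neg_pos.2 h2).le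
      nlinarith
    have h4 := le_of_mul_le_mul_left h3 hm
    have h5 : 0 ≤ ((k : ℝ) + 1) ^ 2 * -sqrtCoeff (m + k + 1) := by
      have := neg_pos.2 h2
      positivity
    linarith

open Filter Topology

lemma tendsto_sqrtCoeff_ratio :
    Tendsto (fun n => sqrtCoeff n / sqrtCoeff (n + 1)) atTop (𝓝 1) := by
  have h1 : Tendsto (fun n : ℕ => (3 / 2 : ℝ) / ((n : ℝ) - 1 / 2)) atTop (𝓝 0) :=
    Tendsto.const_div_atTop
      (tendsto_atTop_add_const_right _ _ tendsto_natCast_atTop_atTop) _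
  have h2 := h1.const_add 1
  rw [add_zero] at h2
  refine h2.congr' ?_
  filter_upwards [eventually_ge_atTop 1] with n hn
  have hn' : (1 : ℝ) ≤ n := by exact_mod_cast hn
  have h : (n : ℝ) - 1 / 2 ≠ 0 := by linarith
  rw [eq_div_iff (sqrtCoeff_ne_zero _)]
  have := sqrtCoeff_succ n
  have h3 : sqrtCoeff n = sqrtCoeff (n + 1) * (n + 1) / (n - 1 / 2) := by
    rw [this, mul_div_cancel_right₀ _ h]
  have h4 : (2 : ℝ) * n - 1 ≠ 0 := by linarith
  rw [h3]
  field_simp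
  ring

lemma tendsto_sqrtCoeff_sub_ratio (k : ℕ) :
    Tendsto (fun n => sqrtCoeff (n - k) / sqrtCoeff n) atTop (𝓝 1) := by
  induction k with
  | zero => simp [div_self (sqrtCoeff_ne_zero _)]
  | succ k ih =>
    have h := (tendsto_sqrtCoeff_ratio.comp (tendsto_sub_atTop_nat (k + 1))).mul ih
    rw [one_mul] at h
    refine h.congr' ?_
    filter_upwards [eventually_ge_atTop (k + 1)] with n hn
    simp only [Function.comp]
    rw [show n - (k + 1) + 1 = n - k by omega, div_mul_div_cancel₀ (sqrtCoeff_ne_zero _)]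

/-- Darboux transfer for a square-root singularity: the coefficients of `√(1 - c X) * g`
are asymptotic to those of `√(1 - c X)` times the value of `g` at `c⁻¹`. -/
lemma PowerSeries.tendsto_coeff_sqrtOneSub_mul_div {c : ℝ} (hc : c ≠ 0) (g : PowerSeries ℝ)
    (hg : Summable fun k : ℕ => ((k : ℝ) + 1) ^ 2 * |coeff k g * c⁻¹ ^ k|) :
    Tendsto (fun n => coeff n (sqrtOneSub c * g) / (sqrtCoeff n * c ^ n)) atTop
      (𝓝 (∑' k, coeff k g * c⁻¹ ^ k)) := by
  let F : ℕ → ℕ → ℝ := fun n k =>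
    if k ≤ n then sqrtCoeff (n - k) / sqrtCoeff n * (coeff k g * c⁻¹ ^ k) else 0
  have hF : ∀ n, coeff n (sqrtOneSub c * g) / (sqrtCoeff n * c ^ n) = ∑' k, F n k := by
    intro n
    rw [tsum_eq_sum (s := range (n + 1)) fun k hk => if_neg (by simpa using hk), mul_comm,
      coeff_mul, Nat.sum_antidiagonal_eq_sum_range_succ_mk, sum_div]
    refine sum_congr rfl fun k hk => ?_
    have hk' : k ≤ n := Nat.lt_succ_iff.1 (mem_range.1 hk)
    have hs := sqrtCoeff_ne_zero n
    simp only [if_pos hk', coeff_sqrtOneSub]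
    rw [show c ^ n = c ^ (n - k) * c ^ k by rw [← pow_add, Nat.sub_add_cancel hk'], inv_pow]
    field_simp
  simp only [hF]
  refine tendsto_tsum_of_dominated_convergence (hg.mul_left 2) (fun k => ?_)
    (Eventually.of_forall fun n k => ?_)
  · have h := (tendsto_sqrtCoeff_sub_ratio k).mul_const (coeff k g * c⁻¹ ^ k)
    rw [one_mul] at h
    refine h.congr' ?_
    filter_upwards [eventually_ge_atTop k] with n hn
    exact (if_pos hn).symm
  · by_cases hk : k ≤ n
    · simp only [F, if_pos hk, Real.norm_eq_abs]
      rw [abs_mul, ← mul_assoc]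
      refine mul_le_mul_of_nonneg_right ?_ (abs_nonneg _)
      rw [abs_div, div_le_iff₀ (abs_pos.2 (sqrtCoeff_ne_zero n))]
      exact abs_sqrtCoeff_le hk
    · simp only [F, if_neg hk, norm_zero]
      positivity

namespace PowerSeries

lemma coeff_X_mul_derivative (g : PowerSeries ℝ) (n : ℕ) :
    coeff n (X * derivative ℝ g) = n * coeff n g := by
  rcases n with _ | n
  · simp
  · rw [coeff_succ_X_mul, coeff_derivative]
    push_cast
    ring

/-- A square root of `(1 + (ρ + ρ²) X + ρ X²) / (1 - X)` satisfies a linear differential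
equation. -/
lemma derivative_of_mul_self_mul_one_sub_X {ρ : ℝ} {g : PowerSeries ℝ} (hg0 : coeff 0 g = 1)
    (hg : g * g * (1 - X) = 1 + C (ρ + ρ ^ 2) * X + C ρ * (X * X)) :
    C 2 * (derivative ℝ g + C (ρ + ρ ^ 2 - 1) * (X * derivative ℝ g)
        - C (ρ ^ 2) * (X * (X * derivative ℝ g)) - C ρ * (X * (X * (X * derivative ℝ g))))
      = C (1 + ρ + ρ ^ 2) * g + C (2 * ρ) * (X * g) - C ρ * (X * (X * g)) := by
  have hgne : g ≠ 0 := by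
    rintro rfl
    simp at hg0
  have hd := congrArg (derivative ℝ) hg
  simp only [Derivation.leibniz, map_add, map_sub, smul_eq_mul, derivative_X, derivative_C,
    Derivation.map_one_eq_zero, mul_one, mul_zero, add_zero, zero_add, zero_sub] at hd
  refine mul_left_cancel₀ hgne ?_
  simp only [map_add, map_sub, map_mul, map_pow, map_one, map_ofNat] at hd hg ⊢
  linear_combination (1 + (C ρ + C ρ ^ 2) * X + C ρ * (X * X)) * hd
    - ((C ρ + C ρ ^ 2) + 2 * C ρ * X) * hg

lemma abs_coeff_le_two_pow {ρ : ℝ} (h0 : 0 < ρ) (h1 : ρ < 1 / 2) {g : PowerSeries ℝ}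
    (hg0 : coeff 0 g = 1)
    (hg : g * g * (1 - X) = 1 + C (ρ + ρ ^ 2) * X + C ρ * (X * X)) (n : ℕ) :
    |coeff n g| ≤ 2 ^ n := by
  have hode := derivative_of_mul_self_mul_one_sub_X hg0 hg
  have hrec0 := congrArg (coeff 0) hode
  have hrec1 := congrArg (coeff (0 + 1)) hode
  have hrec := fun n => congrArg (coeff (n + 2)) hode
  simp only [LinearMap.map_add, LinearMap.map_sub, coeff_C_mul, coeff_succ_X_mul,
    coeff_zero_X_mul] at hrec0 hrec1
  simp only [LinearMap.map_add, LinearMap.map_sub, coeff_C_mul, coeff_succ_X_mul,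
    coeff_X_mul_derivative] at hrec
  simp only [coeff_derivative] at hrec hrec0 hrec1
  rw [hg0] at hrec0 hrec1
  norm_num at hrec0 hrec1
  have hρ2 : ρ ^ 2 < 1 / 4 := by nlinarith
  have hρ2' : 0 < ρ ^ 2 := by positivity
  induction n using Nat.strong_induction_on with
  | _ n ih =>
    match n with
    | 0 => simp [hg0]
    | 1 => rw [abs_le]; constructor <;> nlinarith
    | 2 =>
      have h := ih 1 (by norm_num)
      rw [abs_le] at h ⊢
      have e1 : coeff 1 g = (1 + ρ + ρ ^ 2) / 2 := by linarith
      rw [e1] at hrec1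
      constructor <;> nlinarith
    | n + 3 =>
      have i0 := ih n (by omega)
      have i1 := ih (n + 1) (by omega)
      have i2 := ih (n + 2) (by omega)
      have h := hrec n
      push_cast at h
      have hn : (0 : ℝ) ≤ n := n.cast_nonneg
      have e : (2 * ((n : ℝ) + 3)) * coeff (n + 3) g =
          (2 * (n + 2) * (1 - ρ - ρ ^ 2) + (1 + ρ + ρ ^ 2)) * coeff (n + 2) g
          + (2 * (n + 1) * ρ ^ 2 + 2 * ρ) * coeff (n + 1) g
          + (2 * n - 1) * ρ * coeff n g := by
        linear_combination h
      have b2 : |2 * ((n : ℝ) + 2) * (1 - ρ - ρ ^ 2) + (1 + ρ + ρ ^ 2)| ≤ 2 * ((n : ℝ) + 3) := by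
        rw [abs_le]; constructor <;> nlinarith
      have b1 : |2 * ((n : ℝ) + 1) * ρ ^ 2 + 2 * ρ| ≤ (n : ℝ) + 3 := by
        rw [abs_le]; constructor <;> nlinarith
      have b0 : |(2 * (n : ℝ) - 1) * ρ| ≤ (n : ℝ) + 3 := by
        rw [abs_le]; constructor <;> nlinarith
      have hbound : |(2 * ((n : ℝ) + 3)) * coeff (n + 3) g| ≤
          2 * ((n : ℝ) + 3) * 2 ^ (n + 2) + (n + 3) * 2 ^ (n + 1) + (n + 3) * 2 ^ n := by
        rw [e]
        refine (abs_add_three _ _ _).trans ?_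
        simp only [abs_mul _ (coeff _ g)]
        gcongr
      rw [abs_mul, abs_of_pos (by positivity)] at hbound
      have hpos : 0 < 2 * ((n : ℝ) + 3) := by positivity
      refine le_of_mul_le_mul_left (hbound.trans ?_) hpos
      have : 0 ≤ ((n : ℝ) + 3) * 2 ^ n := by positivity
      simp only [pow_succ]
      nlinarith

lemma tsum_coeff_mul_pow_ne_zero {ρ : ℝ} (h0 : 0 < ρ) {g : PowerSeries ℝ}
    (hg : g * g * (1 - X) = 1 + C (ρ + ρ ^ 2) * X + C ρ * (X * X))
    (hs : Summable fun k => |coeff k g * ρ ^ k|) : ∑' k, coeff k g * ρ ^ k ≠ 0 := by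
  have hgg : g * g = (1 + C (ρ + ρ ^ 2) * X + C ρ * (X * X)) * mk 1 := by
    rw [← hg, mul_assoc, mul_comm (1 - X), mk_one_mul_one_sub_eq_one, mul_one]
  have hnonneg : ∀ n, 0 ≤ coeff n (g * g) := by
    intro n
    rw [hgg, coeff_mul]
    refine sum_nonneg fun p _ => mul_nonneg ?_ (by simp)
    rw [← pow_two]
    simp only [map_add (coeff _), coeff_C_mul, coeff_one, coeff_X, coeff_X_pow]
    positivity
  have hone : coeff 0 (g * g) = 1 := by rw [hgg]; simp
  have hprod : ∀ n, ∑ p ∈ antidiagonal n, coeff p.1 g * ρ ^ p.1 * (coeff p.2 g * ρ ^ p.2) =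
      coeff n (g * g) * ρ ^ n := by
    intro n
    rw [coeff_mul, sum_mul]
    refine sum_congr rfl fun p hp => ?_
    rw [← HasAntidiagonal.mem_antidiagonal.1 hp, pow_add]
    ring
  have hs' : Summable fun k => ‖coeff k g * ρ ^ k‖ := hs
  have hmul := tsum_mul_tsum_eq_tsum_sum_antidiagonal_of_summable_norm hs' hs'
  have hsum := (summable_norm_sum_mul_antidiagonal_of_summable_norm hs' hs').of_norm
  simp only [hprod] at hmul hsum
  have hle := hsum.le_tsum 0 fun n _ => mul_nonneg (hnonneg n) (pow_nonneg h0.le n)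
  rw [hone, ← hmul] at hle
  intro h
  norm_num [h] at hle

end PowerSeries

open PowerSeries in
lemma mk_L_quadratic :
    (X * PowerSeries.mk fun n => (L n : ℝ)) * (X * PowerSeries.mk fun n => (L n : ℝ)) * (1 - X) =
      (1 - X) * (1 - X) * (X * PowerSeries.mk fun n => (L n : ℝ)) - X * X := by
  set l : PowerSeries ℝ := PowerSeries.mk fun n => (L n : ℝ) with hl
  have h : l = X * (PowerSeries.mk 1 + l + l * l) := by
    ext n
    rcases n with _ | n
    · simp [hl, L_zero]
    · rw [coeff_succ_X_mul]
      simp [coeff_mul, hl, L_succ]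
  have h1 := mk_one_mul_one_sub_eq_one ℝ
  linear_combination (-X * (1 - X)) * h - X * X * h1

/-- `1 - X - 2 X L(X)`, the square root of the discriminant of the quadratic equation satisfied by
the generating series of `L`. -/
noncomputable def sqrtDiscr : PowerSeries ℝ :=
  1 - PowerSeries.X - 2 * (PowerSeries.X * PowerSeries.mk fun n => (L n : ℝ))

lemma coeff_sqrtDiscr (n : ℕ) : PowerSeries.coeff (n + 2) sqrtDiscr = -2 * L (n + 1) := by
  rw [sqrtDiscr, ← map_ofNat PowerSeries.C 2]
  simp [PowerSeries.coeff_succ_X_mul, PowerSeries.coeff_one, PowerSeries.coeff_X]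

open PowerSeries in
lemma sqrtDiscr_mul_self {ρ : ℝ} (hρ : ρ ≠ 0) (hroot : ρ ^ 3 + ρ ^ 2 + 3 * ρ = 1) :
    sqrtDiscr * sqrtDiscr * (1 - X) =
      (1 - C ρ⁻¹ * X) * (1 + C (ρ + ρ ^ 2) * X + C ρ * (X * X)) := by
  have hinv : ρ⁻¹ = 3 + ρ + ρ ^ 2 := by
    field_simp
    linarith
  have hC := congrArg (C (R := ℝ)) hroot
  rw [hinv, sqrtDiscr]
  simp only [map_add, map_mul, map_pow, map_one, map_ofNat] at hC ⊢
  have := mk_L_quadratic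
  linear_combination 4 * this + (X ^ 2 + X ^ 3 + C ρ * X ^ 2) * hC

/-- The ratio of consecutive coefficients of `L` tends to `ρ`. -/
lemma tendsto_L_ratio {ρ : ℝ} (hρ : ρ ∈ Set.Ioo (0 : ℝ) 1)
    (hroot : ρ ^ 3 + ρ ^ 2 + 3 * ρ = 1) :
    Tendsto (fun n => (L n : ℝ) / L (n + 1)) atTop (𝓝 ρ) := by
  have h0 := hρ.1
  have hhalf : ρ < 1 / 2 := by nlinarith [pow_pos h0 2, pow_pos h0 3]
  obtain ⟨g, hg⟩ : ∃ g, sqrtDiscr = PowerSeries.sqrtOneSub ρ⁻¹ * g := by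
    refine ⟨(PowerSeries.sqrtOneSub ρ⁻¹)⁻¹ * sqrtDiscr, ?_⟩
    rw [← mul_assoc, PowerSeries.mul_inv_cancel, one_mul]
    rw [← PowerSeries.coeff_zero_eq_constantCoeff_apply, PowerSeries.coeff_sqrtOneSub]
    simp [sqrtCoeff_zero]
  have hg0 : PowerSeries.coeff 0 g = 1 := by
    have h := congrArg (PowerSeries.coeff 0) hg
    rw [PowerSeries.coeff_mul, HasAntidiagonal.antidiagonal_zero, sum_singleton, PowerSeries.coeff_sqrtOneSub,
      sqrtCoeff_zero] at h
    simpa [sqrtDiscr] using h.symm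
  have hgg : g * g * (1 - PowerSeries.X) = 1 + PowerSeries.C (ρ + ρ ^ 2) * PowerSeries.X
      + PowerSeries.C ρ * (PowerSeries.X * PowerSeries.X) := by
    have hsq := PowerSeries.sqrtOneSub_mul_self ρ⁻¹
    have h := sqrtDiscr_mul_self h0.ne' hroot
    rw [hg, ← hsq] at h
    have hne : PowerSeries.sqrtOneSub ρ⁻¹ * PowerSeries.sqrtOneSub ρ⁻¹ ≠ 0 := by
      rw [hsq]
      intro h
      simpa using congrArg (PowerSeries.coeff 0) h
    refine mul_left_cancel₀ hne ?_
    linear_combination h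
  have hbound : ∀ k, |PowerSeries.coeff k g * ρ ^ k| ≤ (2 * ρ) ^ k := fun k => by
    rw [abs_mul, abs_of_pos (pow_pos h0 k), mul_pow]
    exact mul_le_mul_of_nonneg_right
      (PowerSeries.abs_coeff_le_two_pow h0 hhalf hg0 hgg k) (pow_pos h0 k).le
  have hnorm : ‖2 * ρ‖ < 1 := by
    rw [Real.norm_eq_abs, abs_of_pos (by positivity)]
    linarith
  have hs1 : Summable fun k : ℕ => ((k : ℝ) + 1) ^ 2 * (2 * ρ) ^ k := by
    have h := ((summable_pow_mul_geometric_of_norm_lt_one 2 hnorm).add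
      ((summable_pow_mul_geometric_of_norm_lt_one 1 hnorm).mul_left 2)).add
      (summable_geometric_of_norm_lt_one hnorm)
    refine h.congr fun k => ?_
    ring
  have hs2 : Summable fun k : ℕ => ((k : ℝ) + 1) ^ 2 * |PowerSeries.coeff k g * ρ ^ k| :=
    hs1.of_nonneg_of_le (fun k => by positivity) fun k => by
      gcongr
      exact hbound k
  have hs3 : Summable fun k : ℕ => |PowerSeries.coeff k g * ρ ^ k| :=
    (summable_geometric_of_norm_lt_one hnorm).of_nonneg_of_le (fun k => abs_nonneg _) hbound
  have hG := PowerSeries.tsum_coeff_mul_pow_ne_zero h0 hgg hs3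
  have hlim := PowerSeries.tendsto_coeff_sqrtOneSub_mul_div (inv_ne_zero h0.ne') g
    (by simpa only [inv_inv] using hs2)
  simp only [inv_inv, ← hg] at hlim
  have hratio := ((hlim.div (hlim.comp (tendsto_add_atTop_nat 1)) hG).mul
    tendsto_sqrtCoeff_ratio).mul_const ρ
  rw [div_self hG, one_mul, one_mul] at hratio
  refine (tendsto_add_atTop_iff_nat 1).1
    (((tendsto_add_atTop_iff_nat 2).2 hratio).congr fun n => ?_)
  have e1 := sqrtCoeff_ne_zero (n + 2)
  have e2 := sqrtCoeff_ne_zero (n + 2 + 1)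
  have hρ0 := h0.ne'
  simp only [Pi.div_apply, Function.comp, coeff_sqrtDiscr, inv_pow, show n + 2 + 1 = n + 1 + 2 by ring]
    at e2 ⊢
  have hL : (L (n + 1 + 1) : ℝ) ≠ 0 := by
    rw [L_succ]
    positivity
  field_simp
  ring

theorem nhnf_density (ρ : ℝ) (hρ : ρ ∈ Set.Ioo (0 : ℝ) 1)
    (hroot : ρ ^ 3 + ρ ^ 2 + 3 * ρ = 1) :
    Filter.Tendsto
      (fun n : ℕ =>
        (Nat.card {t : Term // Nhnf t ∧ t.size = n} : ℝ) / (L n : ℝ))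
      Filter.atTop (nhds ρ) := by
  refine (tendsto_add_atTop_iff_nat 2).1
    (((tendsto_add_atTop_iff_nat 1).2 (tendsto_L_ratio hρ hroot)).congr fun n => ?_)
  rw [← nhnfCount_add_two, nhnfCount]
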